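/- Let r̂ : [T₋,T₊] → ℝ³ be a trajectory with v̂ = ∂_t r̂, R_n → 0, and let P_n, T_n^{ij}, f_n be continuous fields on the tubes Ω̂_n = {(t,x) : T₋ ≤ t ≤ T₊, |x − r̂(t)| ≤ R_n} (P_n, f_n : Ω̂_n → ℝ³, T_n^{ij} real, i,j ∈ {1,2,3}, and P_n, T_n^{ij} C¹) satisfying the momentum equation ∂_tP_n + ∂_iT_n^{ij} = f_n on Ω̂_n. Assume |∫_{B(r̂(t),R_n)} P_n(t,x) dx| ≤ C for all n and t. Then: (1) there is a subsequence along which ∫_{B(r̂(t₀),R_n)} P_n(t₀) dx converges to some p_∞ ∈ ℝ³; (2) if moreover Q₀(t) = ∫_{t₀}^{t} ∫_{∂B(r̂(t′),R_n)} n̄_i T_n^{ij} dσ dt′ → 0 and Q₀₁(t) = ∫_{t₀}^{t} ∫_{∂B(r̂(t′),R_n)} P_n (v̂·n̄) dσ dt′ → 0 uniformly in t, then along this subsequence ∫_{B(r̂(t),R_n)} P_n(t) dx = ∫_{t₀}^{t} ∫_{B(r̂(t′),R_n)} f_n dx dt′ + p_∞ + Q₀₀(t) with sup_{t∈[T₋,T₊]}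 |Q₀₀(t)| → 0 as n → ∞. -/

import Mathlib

noncomputable section

open MeasureTheory Complex Filter Topology Metric

/-- Physical space `ℝ³` with the Euclidean metric. -/
abbrev V3 : Type := EuclideanSpace ℝ (Fin 3)

/-- Dot product of two triples of reals. -/
def dot3 (v w : Fin 3 → ℝ) : ℝ := ∑ i, v i * w i

/-- Cross product in `ℝ³`. -/
def cross3 (v w : Fin 3 → ℝ) : Fin 3 → ℝ :=
  ![v 1 * w 2 - v 2 * w 1, v 2 * w 0 - v 0 * w 2, v 0 * w 1 - v 1 * w 0]

/-- Matrix (as nested function) applied to a vector. -/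
def matVec (M : Fin 3 → Fin 3 → ℝ) (v : Fin 3 → ℝ) : Fin 3 → ℝ := fun j => ∑ i, M j i * v i

/-- Partial derivative in time of a function of `(t, x)`. -/
def ptD {F : Type} [NormedAddCommGroup F] [NormedSpace ℝ F]
    (f : ℝ × V3 → F) (p : ℝ × V3) : F := fderiv ℝ f p (1, 0)

/-- Partial derivative in the `i`-th spatial direction of a function of `(t, x)`. -/
def pxD {F : Type} [NormedAddCommGroup F] [NormedSpace ℝ F]
    (i : Fin 3) (f : ℝ × V3 → F) (p : ℝ × V3) : F :=
  fderiv ℝ f p (0, EuclideanSpace.single i 1)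

/-- Partial derivative in the `i`-th direction of a function on space only. -/
def pxS {F : Type} [NormedAddCommGroup F] [NormedSpace ℝ F]
    (i : Fin 3) (f : V3 → F) (x : V3) : F :=
  fderiv ℝ f x (EuclideanSpace.single i 1)

/-- Laplacian of a scalar function on `ℝ³`. -/
def lap3 (f : V3 → ℝ) (x : V3) : ℝ := ∑ i, pxS i (pxS i f) x

/-- Covariant time derivative `∂̃_t = ∂_t + i (q/χ) φ`. -/
def covT (χ q : ℝ) (φ : ℝ × V3 → ℝ) (ψ : ℝ × V3 → ℂ) (p : ℝ × V3) : ℂ :=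
  ptD ψ p + Complex.I * ((q / χ : ℝ) : ℂ) * ((φ p : ℝ) : ℂ) * ψ p

/-- Covariant spatial derivative `∂̃_i = ∂_i − i (q/(χc)) A_i`. -/
def covX (χ q c : ℝ) (A : ℝ × V3 → Fin 3 → ℝ) (i : Fin 3)
    (ψ : ℝ × V3 → ℂ) (p : ℝ × V3) : ℂ :=
  pxD i ψ p - Complex.I * ((q / (χ * c) : ℝ) : ℂ) * ((A p i : ℝ) : ℂ) * ψ p

/-- The NLS equation `i ∂̃_t ψ = (χ/(2m)) ( −∇̃²ψ + G'_a(|ψ|²) ψ )` at a point,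
with the scaled nonlinearity `G'_a(s) = a⁻² G'₁(a³ s)`. -/
def SatisfiesNLS (χ m q c a : ℝ) (G1' : ℝ → ℝ) (φ : ℝ × V3 → ℝ)
    (A : ℝ × V3 → Fin 3 → ℝ) (ψ : ℝ × V3 → ℂ) (p : ℝ × V3) : Prop :=
  Complex.I * covT χ q φ ψ p =
    ((χ / (2 * m) : ℝ) : ℂ) *
      (-(∑ i, covX χ q c A i (covX χ q c A i ψ) p) +
        (((a ^ (2 : ℕ))⁻¹ * G1' (a ^ (3 : ℕ) * Complex.normSq (ψ p)) : ℝ) : ℂ) * ψ p)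

/-- The NLS equation with an unscaled nonlinearity `G'`. -/
def SatisfiesNLS' (χ m q c : ℝ) (G' : ℝ → ℝ) (φ : ℝ × V3 → ℝ)
    (A : ℝ × V3 → Fin 3 → ℝ) (ψ : ℝ × V3 → ℂ) (p : ℝ × V3) : Prop :=
  Complex.I * covT χ q φ ψ p =
    ((χ / (2 * m) : ℝ) : ℂ) *
      (-(∑ i, covX χ q c A i (covX χ q c A i ψ) p) +
        ((G' (Complex.normSq (ψ p)) : ℝ) : ℂ) * ψ p)

/-- Charge density `ρ = q |ψ|²`. -/
def rhoD (q : ℝ) (ψ : ℝ × V3 → ℂ) (p : ℝ × V3) : ℝ := q * Complex.normSq (ψ p)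

/-- Current density `J = −i (qχ/(2m)) (ψ* ∇̃ψ − ψ (∇̃ψ)*)`. -/
def JD (χ m q c : ℝ) (A : ℝ × V3 → Fin 3 → ℝ) (ψ : ℝ × V3 → ℂ)
    (p : ℝ × V3) : Fin 3 → ℝ := fun i =>
  (-Complex.I * ((q * χ / (2 * m) : ℝ) : ℂ) *
    ((starRingEnd ℂ) (ψ p) * covX χ q c A i ψ p
      - ψ p * (starRingEnd ℂ) (covX χ q c A i ψ p))).re

/-- Momentum density `P = (iχ/2) (ψ (∇̃ψ)* − ψ* ∇̃ψ)`. -/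
def PD (χ q c : ℝ) (A : ℝ × V3 → Fin 3 → ℝ) (ψ : ℝ × V3 → ℂ)
    (p : ℝ × V3) : Fin 3 → ℝ := fun i =>
  (Complex.I * ((χ / 2 : ℝ) : ℂ) *
    (ψ p * (starRingEnd ℂ) (covX χ q c A i ψ p)
      - (starRingEnd ℂ) (ψ p) * covX χ q c A i ψ p)).re

/-- Energy density `u = (χ²/(2m)) ( |∇̃ψ|² + G_a(|ψ|²) )` for an antiderivative `Ga`. -/
def uD (χ m q c : ℝ) (Ga : ℝ → ℝ) (A : ℝ × V3 → Fin 3 → ℝ) (ψ : ℝ × V3 → ℂ)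
    (p : ℝ × V3) : ℝ :=
  (χ ^ 2 / (2 * m)) * ((∑ i, Complex.normSq (covX χ q c A i ψ p)) + Ga (Complex.normSq (ψ p)))

/-- Entries `T^{ij}` of the energy–momentum (stress) tensor of the NLS. -/
def TD (χ m q c : ℝ) (Ga : ℝ → ℝ) (φ : ℝ × V3 → ℝ) (A : ℝ × V3 → Fin 3 → ℝ)
    (ψ : ℝ × V3 → ℂ) (i j : Fin 3) (p : ℝ × V3) : ℝ :=
  if i = j then
    uD χ m q c Ga A ψ p - (χ ^ 2 / m) * Complex.normSq (covX χ q c A i ψ p)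
      + (Complex.I * ((χ / 2 : ℝ) : ℂ) *
          (ψ p * (starRingEnd ℂ) (covT χ q φ ψ p)
            - (starRingEnd ℂ) (ψ p) * covT χ q φ ψ p)).re
  else
    (-(((χ ^ 2 / (2 * m) : ℝ)) : ℂ) *
        (covX χ q c A i ψ p * (starRingEnd ℂ) (covX χ q c A j ψ p)
          + covX χ q c A j ψ p * (starRingEnd ℂ) (covX χ q c A i ψ p))).re

/-- Electric field `E = −∇φ − (1/c) ∂_t A`. -/
def ED (c : ℝ) (φ : ℝ × V3 → ℝ) (A : ℝ × V3 → Fin 3 → ℝ) (p : ℝ × V3) : Fin 3 → ℝ :=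
  fun i => -(pxD i φ p) - (1 / c) * ptD A p i

/-- Magnetic field `B = ∇ × A`. -/
def BD (A : ℝ × V3 → Fin 3 → ℝ) (p : ℝ × V3) : Fin 3 → ℝ :=
  ![pxD 1 A p 2 - pxD 2 A p 1, pxD 2 A p 0 - pxD 0 A p 2, pxD 0 A p 1 - pxD 1 A p 0]

/-- Lorentz force density `f = ρ E + (1/c) J × B`. -/
def fD (χ m q c : ℝ) (φ : ℝ × V3 → ℝ) (A : ℝ × V3 → Fin 3 → ℝ) (ψ : ℝ × V3 → ℂ)
    (p : ℝ × V3) : Fin 3 → ℝ := fun j =>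
  rhoD q ψ p * ED c φ A p j + (1 / c) * cross3 (JD χ m q c A ψ p) (BD A p) j

/-- A tubular neighborhood `Ω̂` of a trajectory. -/
def Tube (Tm Tp : ℝ) (r : ℝ → V3) (R : ℝ) : Set (ℝ × V3) :=
  {p | p.1 ∈ Set.Icc Tm Tp ∧ ‖p.2 - r p.1‖ ≤ R}

/-- Outward unit normal on the sphere of radius `R` centered at `ctr`. -/
def nrm (ctr : V3) (R : ℝ) (x : V3) : Fin 3 → ℝ := fun i => (x i - ctr i) / R

/-- A trajectory: a `C²` curve with bounded first and second derivatives on `[T₋, T₊]`. -/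
def IsTrajectory (Tm Tp : ℝ) (r : ℝ → V3) : Prop :=
  ContDiff ℝ 2 r ∧ ∃ C : ℝ, ∀ t ∈ Set.Icc Tm Tp, ‖deriv r t‖ ≤ C ∧ ‖deriv (deriv r) t‖ ≤ C

/-- Adjacent (restricted) charge value `ρ̄_n(t)`. -/
def rbar (q : ℝ) (rhat : ℝ → V3) (R : ℕ → ℝ) (ψ : ℕ → ℝ × V3 → ℂ) (n : ℕ) (t : ℝ) : ℝ :=
  ∫ x in closedBall (rhat t) (R n), rhoD q (ψ n) (t, x)

/-- Adjacent charge center `r_n(t)`. -/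
def rcen (q : ℝ) (rhat : ℝ → V3) (R : ℕ → ℝ) (ψ : ℕ → ℝ × V3 → ℂ) (n : ℕ) (t : ℝ) : V3 :=
  (rbar q rhat R ψ n t)⁻¹ • ∫ x in closedBall (rhat t) (R n), rhoD q (ψ n) (t, x) • x

/-- Velocity of the adjacent charge center. -/
def vcen (Tm Tp q : ℝ) (rhat : ℝ → V3) (R : ℕ → ℝ) (ψ : ℕ → ℝ × V3 → ℂ)
    (n : ℕ) (t : ℝ) : V3 :=
  derivWithin (rcen q rhat R ψ n) (Set.Icc Tm Tp) t

end

section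

open MeasureTheory Complex Filter Topology Metric
open scoped ENNReal

theorem unif_aux {X : Type*} [MetricSpace X] [MeasurableSpace X] [BorelSpace X]
    [SecondCountableTopology X] (μ ν : Measure X) [IsFiniteMeasure μ] [IsFiniteMeasure ν]
    (h k : ℝ → ℝ≥0∞) (hμ : ∀ x r, μ (ball x r) = h r) (hν : ∀ x r, ν (ball x r) = k r)
    (hk : ∀ r, 0 < r → k r ≠ 0) (hk' : ∀ r, k r ≠ ∞)
    (U : Set X) (hU : IsOpen U) :
    μ U ≤ liminf (fun n : ℕ => h (1 / ((n : ℝ) + 1)) / k (1 / ((n : ℝ) + 1))) atTop * ν U := by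
  set r : ℕ → ℝ := fun n => 1 / ((n : ℝ) + 1) with hr
  have hrpos : ∀ n, 0 < r n := fun n => by simp only [hr]; positivity
  have hr0 : Tendsto r atTop (𝓝 0) := tendsto_one_div_add_atTop_nhds_zero_nat
  let D : ℕ → Set (X × X) := fun n => {p | p.2 ∈ U ∧ dist p.2 p.1 < r n}
  have hD : ∀ n, MeasurableSet (D n) := fun n =>
    ((hU.preimage continuous_snd).inter
      (isOpen_lt (continuous_snd.dist continuous_fst) continuous_const)).measurableSet
  have hD1 : ∀ n x, Prod.mk x ⁻¹' D n = U ∩ ball x (r n) := by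
    intro n x; ext y; simp [D]
  have hmeas : ∀ n, Measurable (fun x => ν (U ∩ ball x (r n)) / k (r n)) := by
    intro n
    have := measurable_measure_prodMk_left (ν := ν) (hD n)
    simp only [hD1] at this
    exact this.div_const _
  have hintg : ∀ n, ∫⁻ x, ν (U ∩ ball x (r n)) / k (r n) ∂μ = h (r n) / k (r n) * ν U := by
    intro n
    have h1 : ∫⁻ x, ν (U ∩ ball x (r n)) ∂μ = h (r n) * ν U := by
      have e1 := Measure.prod_apply (μ := μ) (ν := ν) (hD n)
      have e2 := Measure.prod_apply_symm (μ := μ) (ν := ν) (hD n)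
      simp only [hD1] at e1
      rw [← e1, e2]
      have : ∀ y, μ ((fun x => (x, y)) ⁻¹' D n) = U.indicator (fun _ => h (r n)) y := by
        intro y
        by_cases hy : y ∈ U
        · rw [Set.indicator_of_mem hy, ← hμ y (r n)]
          congr 1; ext x; simp [D, hy, dist_comm]
        · rw [Set.indicator_of_notMem hy]
          have : (fun x => (x, y)) ⁻¹' D n = ∅ := by ext x; simp [D, hy]
          simp [this]
      simp only [this]
      rw [lintegral_indicator hU.measurableSet]; simp
    simp only [div_eq_mul_inv]
    rw [lintegral_mul_const', h1]
    · ring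
    · exact ENNReal.inv_ne_top.2 (hk _ (hrpos n))
  have hpt : ∀ x, U.indicator (fun _ => (1 : ℝ≥0∞)) x ≤
      liminf (fun n => ν (U ∩ ball x (r n)) / k (r n)) atTop := by
    intro x
    by_cases hx : x ∈ U
    · rw [Set.indicator_of_mem hx]
      obtain ⟨e, he, hb⟩ := Metric.isOpen_iff.1 hU x hx
      refine le_liminf_of_le (by isBoundedDefault) ?_
      filter_upwards [hr0.eventually (gt_mem_nhds he)] with n hn
      have : U ∩ ball x (r n) = ball x (r n) :=
        Set.inter_eq_right.2 ((ball_subset_ball hn.le).trans hb)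
      rw [this, hν, ENNReal.div_self (hk _ (hrpos n)) (hk' _)]
    · rw [Set.indicator_of_notMem hx]; exact zero_le
  calc μ U = ∫⁻ x, U.indicator (fun _ => (1 : ℝ≥0∞)) x ∂μ := by
        rw [lintegral_indicator hU.measurableSet]; simp
    _ ≤ ∫⁻ x, liminf (fun n => ν (U ∩ ball x (r n)) / k (r n)) atTop ∂μ := lintegral_mono hpt
    _ ≤ liminf (fun n => ∫⁻ x, ν (U ∩ ball x (r n)) / k (r n) ∂μ) atTop :=
        lintegral_liminf_le hmeas
    _ = liminf (fun n => h (r n) / k (r n) * ν U) atTop := by simp only [hintg]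
    _ = liminf (fun n => h (r n) / k (r n)) atTop * ν U := by
        by_cases h0 : ν U = 0
        · simp [h0]
        simp only [mul_comm _ (ν U)]
        rw [ENNReal.liminf_const_mul_of_ne_top (measure_ne_top _ _)]

theorem unif_prop {X : Type*} [MetricSpace X] [MeasurableSpace X] [BorelSpace X]
    [SecondCountableTopology X] [Nonempty X]
    (μ ν : Measure X) [IsFiniteMeasure μ] [IsFiniteMeasure ν]
    (hμ0 : μ ≠ 0) (hν0 : ν ≠ 0)
    (hμ : ∀ x y r, μ (ball x r) = μ (ball y r)) (hν : ∀ x y r, ν (ball x r) = ν (ball y r)) :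
    ν Set.univ • μ = μ Set.univ • ν := by
  have key : ∀ (μ : Measure X), μ ≠ 0 → (∀ x y r, μ (ball x r) = μ (ball y r)) →
      ∀ x r, 0 < r → μ (ball x r) ≠ 0 := by
    intro μ h0 h x r hr hz
    apply h0
    rw [← Measure.measure_univ_eq_zero]
    refine measure_null_of_locally_null _ fun y _ => ⟨ball y r, ?_, ?_⟩
    · exact mem_nhdsWithin_of_mem_nhds (ball_mem_nhds y hr)
    · rw [h y x, hz]
  obtain ⟨x0⟩ := ‹Nonempty X›
  have a1 := unif_aux μ ν (fun r => μ (ball x0 r)) (fun r => ν (ball x0 r))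
    (fun x r => hμ _ _ _) (fun x r => hν _ _ _) (fun r hr => key ν hν0 hν _ _ hr)
    (fun r => measure_ne_top _ _)
  have a2 := unif_aux ν μ (fun r => ν (ball x0 r)) (fun r => μ (ball x0 r))
    (fun x r => hν _ _ _) (fun x r => hμ _ _ _) (fun r hr => key μ hμ0 hμ _ _ hr)
    (fun r => measure_ne_top _ _)
  set l := liminf (fun n : ℕ => μ (ball x0 (1 / ((n : ℝ) + 1))) / ν (ball x0 (1 / ((n : ℝ) + 1)))) atTop
  set l' := liminf (fun n : ℕ => ν (ball x0 (1 / ((n : ℝ) + 1))) / μ (ball x0 (1 / ((n : ℝ) + 1)))) atTop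
  have hll : l * l' ≤ 1 := by
    refine ENNReal.le_liminf_mul.trans ?_
    have : (fun n : ℕ => μ (ball x0 (1 / ((n : ℝ) + 1))) / ν (ball x0 (1 / ((n : ℝ) + 1)))) *
      (fun n : ℕ => ν (ball x0 (1 / ((n : ℝ) + 1))) / μ (ball x0 (1 / ((n : ℝ) + 1)))) =
      fun _ => 1 := by
      funext n
      have p : (0:ℝ) < 1 / ((n : ℝ) + 1) := by positivity
      have m1 := key μ hμ0 hμ x0 _ p
      have n1 := key ν hν0 hν x0 _ p
      have m2 := measure_ne_top μ (ball x0 (1 / ((n : ℝ) + 1)))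
      have n2 := measure_ne_top ν (ball x0 (1 / ((n : ℝ) + 1)))
      simp only [Pi.mul_apply, div_eq_mul_inv] at *
      have e : ∀ a b a' b' : ℝ≥0∞, a * b' * (b * a') = (a * a') * (b * b') := by
        intros; ring
      rw [e, ENNReal.mul_inv_cancel m1 m2, ENNReal.mul_inv_cancel n1 n2, one_mul]
    rw [this]; simp
  have hopen : ∀ U : Set X, IsOpen U → ν Set.univ * μ U = μ Set.univ * ν U := by
    intro U hU
    apply le_antisymm
    · calc ν Set.univ * μ U ≤ (l' * μ Set.univ) * (l * ν U) := by
            gcongr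
            · exact a2 _ isOpen_univ
            · exact a1 U hU
        _ = (l * l') * (μ Set.univ * ν U) := by ring
        _ ≤ 1 * (μ Set.univ * ν U) := by gcongr
        _ = _ := one_mul _
    · calc μ Set.univ * ν U ≤ (l * ν Set.univ) * (l' * μ U) := by
            gcongr
            · exact a1 _ isOpen_univ
            · exact a2 U hU
        _ = (l * l') * (ν Set.univ * μ U) := by ring
        _ ≤ 1 * (ν Set.univ * μ U) := by gcongr
        _ = _ := one_mul _
  have : IsFiniteMeasure (ν Set.univ • μ) := by
    constructor
    simp [ENNReal.mul_lt_top]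
  refine ext_of_generate_finite {s | IsOpen s} BorelSpace.measurable_eq isPiSystem_isOpen ?_ ?_
  · intro U hU; simpa using hopen U hU
  · simpa using hopen _ isOpen_univ

end

section

open MeasureTheory Complex Filter Topology Metric
open scoped ENNReal Pointwise

abbrev S2 : Type := sphere (0 : V3) 1

theorem exists_rot (x y : S2) : ∃ e : V3 ≃ₗᵢ[ℝ] V3, e x = y := by
  refine ⟨(ℝ ∙ ((x : V3) - y))ᗮ.reflection, Submodule.reflection_sub ?_⟩
  have := x.2; have := y.2
  simp_all

theorem rot_image (x y : S2) (e : V3 ≃ₗᵢ[ℝ] V3) (he : e x = y) (r : ℝ) :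
    e '' (Subtype.val '' (ball x r)) = Subtype.val '' (ball y r) := by
  ext z
  constructor
  · rintro ⟨_, ⟨w, hw, rfl⟩, rfl⟩
    refine ⟨⟨e w, by simp⟩, ?_, rfl⟩
    rw [mem_ball, Subtype.dist_eq] at hw ⊢
    simpa [← he] using hw
  · rintro ⟨w, hw, rfl⟩
    refine ⟨e.symm w, ⟨⟨e.symm w, by simp⟩, ?_, rfl⟩, by simp⟩
    rw [mem_ball, Subtype.dist_eq] at hw ⊢
    rw [← e.dist_map]
    simpa [he] using hw

theorem toSphere_unif (x y : S2) (r : ℝ) :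
    (volume : Measure V3).toSphere (ball x r) = (volume : Measure V3).toSphere (ball y r) := by
  obtain ⟨e, he⟩ := exists_rot x y
  rw [Measure.toSphere_apply' _ measurableSet_ball, Measure.toSphere_apply' _ measurableSet_ball,
    ← rot_image x y e he r]
  congr 1
  have : Set.Ioo (0:ℝ) 1 • (e '' (Subtype.val '' (ball x r))) =
      e '' (Set.Ioo (0:ℝ) 1 • (Subtype.val '' (ball x r))) := by
    rw [← Set.image2_smul, ← Set.image2_smul, Set.image_image2, Set.image2_image_right]
    simp
  rw [this]
  have h2 := e.measurePreserving.measure_preimage_equiv (f := e.toMeasurableEquiv) (e '' (Set.Ioo (0:ℝ) 1 • (Subtype.val '' (ball x r))))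
  rw [← h2]
  congr 1
  exact (Set.preimage_image_eq _ e.injective).symm

theorem haus_unif (x y : S2) (r : ℝ) :
    (μH[2] : Measure S2) (ball x r) = (μH[2] : Measure S2) (ball y r) := by
  obtain ⟨e, he⟩ := exists_rot x y
  have i : Isometry (Subtype.val : S2 → V3) := isometry_subtype_coe
  rw [← i.hausdorffMeasure_image (Or.inl (by norm_num)), ← i.hausdorffMeasure_image (Or.inl (by norm_num)),
    ← rot_image x y e he r, e.isometry.hausdorffMeasure_image (Or.inl (by norm_num))]

/-- spherical coordinates -/
noncomputable def sphCoord (p : Fin 2 → ℝ) : V3 :=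
  !₂[Real.cos (p 0) * Real.cos (p 1), Real.cos (p 0) * Real.sin (p 1), Real.sin (p 0)]

theorem sphCoord_lip : ∃ K, LipschitzOnWith K sphCoord (closedBall 0 10) := by
  have h : ContDiff ℝ 1 sphCoord := by
    unfold sphCoord
    rw [contDiff_euclidean]
    intro i
    fin_cases i <;> simp <;> fun_prop
  exact h.contDiffOn.exists_lipschitzOnWith one_ne_zero (convex_closedBall _ _) (isCompact_closedBall _ _)

theorem sphCoord_surj : sphere (0 : V3) 1 ⊆ sphCoord '' (closedBall 0 10) := by
  intro x hx
  have hx' : x 0 ^ 2 + x 1 ^ 2 + x 2 ^ 2 = 1 := by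
    have : ‖x‖ = 1 := by simpa using hx
    have h2 : ‖x‖ ^ 2 = 1 := by rw [this]; norm_num
    rw [EuclideanSpace.norm_sq_eq, Fin.sum_univ_three] at h2
    simpa using h2
  let z : ℂ := ⟨x 0, x 1⟩
  have hz : Real.cos (Real.arcsin (x 2)) = ‖z‖ := by
    rw [Real.cos_arcsin, Complex.norm_def]
    congr 1
    simp [z, Complex.normSq_apply]; linarith
  refine ⟨![Real.arcsin (x 2), Complex.arg z], ?_, ?_⟩
  · rw [mem_closedBall, dist_zero_right, pi_norm_le_iff_of_nonneg (by norm_num)]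
    have hp := Real.pi_lt_four
    have h1 := Real.neg_pi_div_two_le_arcsin (x 2)
    have h2 := Real.arcsin_le_pi_div_two (x 2)
    have h3 := Complex.abs_arg_le_pi z
    intro i
    fin_cases i
    · simp only [Real.norm_eq_abs]
      exact abs_le.2 ⟨by simp; linarith, by simp; linarith⟩
    · simp only [Real.norm_eq_abs]
      simp; linarith
  · have hs : Real.sin (Real.arcsin (x 2)) = x 2 :=
      Real.sin_arcsin (by nlinarith [sq_nonneg (x 0), sq_nonneg (x 1)])
        (by nlinarith [sq_nonneg (x 0), sq_nonneg (x 1)])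
    ext i
    fin_cases i
    · simp [sphCoord, hz, Complex.norm_mul_cos_arg, z]
    · simp [sphCoord, hz, Complex.norm_mul_sin_arg, z]
    · simp [sphCoord, hs]

theorem haus_univ : (μH[2] : Measure S2) Set.univ = (μH[2] : Measure V3) (sphere 0 1) := by
  have i : Isometry (Subtype.val : S2 → V3) := isometry_subtype_coe
  rw [← i.hausdorffMeasure_image (Or.inl (by norm_num))]
  rw [Set.image_univ, Subtype.range_coe]

theorem volume_pi_two : (μH[2] : Measure (Fin 2 → ℝ)) = volume := by
  rw [← hausdorffMeasure_pi_real (ι := Fin 2)]; simp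

instance haus_fin : IsFiniteMeasure (μH[2] : Measure S2) := by
  constructor
  rw [haus_univ]
  obtain ⟨K, hK⟩ := sphCoord_lip
  refine (measure_mono sphCoord_surj).trans_lt ((hK.hausdorffMeasure_image_le (by norm_num)).trans_lt ?_)
  rw [volume_pi_two]
  exact ENNReal.mul_lt_top (by simp) measure_closedBall_lt_top

theorem haus_ne_zero : (μH[2] : Measure S2) ≠ 0 := by
  rw [← Measure.measure_univ_ne_zero, haus_univ]
  let pr : V3 → (Fin 2 → ℝ) := fun x => ![x 0, x 1]
  have hl : LipschitzWith 1 pr := by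
    refine LipschitzWith.of_dist_le_mul fun x y => ?_
    simp only [NNReal.coe_one, one_mul]
    rw [dist_pi_le_iff dist_nonneg]
    have : ∀ i, dist (x i) (y i) ≤ dist x y := by
      intro i
      rw [dist_eq_norm, dist_eq_norm]
      exact PiLp.norm_apply_le (x - y) i
    intro i
    fin_cases i
    · exact this 0
    · exact this 1
  have hs : closedBall (0 : Fin 2 → ℝ) (1/2) ⊆ pr '' sphere 0 1 := by
    intro p hp
    rw [mem_closedBall, dist_zero_right, pi_norm_le_iff_of_nonneg (by norm_num)] at hp
    have h0 := abs_le.1 (hp 0); have h1 := abs_le.1 (hp 1)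
    refine ⟨!₂[p 0, p 1, Real.sqrt (1 - p 0 ^ 2 - p 1 ^ 2)], ?_, ?_⟩
    · rw [mem_sphere, dist_zero_right, EuclideanSpace.norm_eq, Fin.sum_univ_three]
      simp
      rw [Real.sq_sqrt]
      · ring
      · nlinarith
    · ext i; fin_cases i <;> simp [pr]
  have h := (measure_mono hs).trans (hl.hausdorffMeasure_image_le (d := 2) (by norm_num) _)
  intro h0
  rw [h0, volume_pi_two] at h
  simp only [mul_zero] at h
  exact (measure_closedBall_pos volume (0 : Fin 2 → ℝ) (r := 1/2) (by norm_num)).not_ge h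

theorem exists_sphere_const : ∃ κ : ℝ≥0∞, κ ≠ ∞ ∧
    (volume : Measure V3).toSphere = κ • (μH[2] : Measure S2) := by
  have : Nonempty S2 := ⟨⟨EuclideanSpace.single 0 1, by simp⟩⟩
  have h := unif_prop (μH[2] : Measure S2) (volume : Measure V3).toSphere haus_ne_zero
    (Measure.toSphere_ne_zero _) haus_unif toSphere_unif
  have hu : (μH[2] : Measure S2) Set.univ ≠ 0 := Measure.measure_univ_ne_zero.2 haus_ne_zero
  have hu' : (μH[2] : Measure S2) Set.univ ≠ ∞ := measure_ne_top _ _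
  refine ⟨((μH[2] : Measure S2) Set.univ)⁻¹ * (volume : Measure V3).toSphere Set.univ, ?_, ?_⟩
  · exact ENNReal.mul_ne_top (ENNReal.inv_ne_top.2 hu) (measure_ne_top _ _)
  · rw [← smul_smul, h, smul_smul, ENNReal.inv_mul_cancel hu hu', one_smul]

end

section

open MeasureTheory Complex Filter Topology Metric
open scoped ENNReal Pointwise

theorem polar_annulus (H : V3 → ℝ) (ρ : ℝ) (h0 : 0 < ρ) (h1 : ρ < 1) :
    ∫ x in ball (0 : V3) 1 \ ball 0 ρ, H (‖x‖⁻¹ • x) =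
      (1 - ρ ^ 3) / 3 * ∫ w : S2, H w ∂(volume : Measure V3).toSphere := by
  let I : Set (Set.Ioi (0:ℝ)) := Set.Iio ⟨1, Set.mem_Ioi.2 one_pos⟩ \ Set.Iio ⟨ρ, Set.mem_Ioi.2 h0⟩
  have hI : MeasurableSet I := MeasurableSet.diff measurableSet_Iio measurableSet_Iio
  have hmeas : (Measure.volumeIoiPow 2).real I = (1 - ρ ^ 3) / 3 := by
    rw [measureReal_def, measure_sdiff (Set.Iio_subset_Iio (by exact h1.le)) measurableSet_Iio.nullMeasurableSet,
      Measure.volumeIoiPow_apply_Iio, Measure.volumeIoiPow_apply_Iio, ← ENNReal.ofReal_sub,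
      ENNReal.toReal_ofReal]
    · norm_num; ring
    · have : ρ ^ 3 ≤ 1 := pow_le_one₀ h0.le h1.le
      norm_num; linarith
    · positivity
    · rw [Measure.volumeIoiPow_apply_Iio]; simp
  let G : S2 × Set.Ioi (0:ℝ) → ℝ := fun p => H p.1 * I.indicator (fun _ => (1:ℝ)) p.2
  have hm : MeasurableSet (ball (0 : V3) 1 \ ball 0 ρ) := MeasurableSet.diff measurableSet_ball measurableSet_ball
  calc ∫ x in ball (0 : V3) 1 \ ball 0 ρ, H (‖x‖⁻¹ • x)
      = ∫ x : V3, (ball (0 : V3) 1 \ ball 0 ρ).indicator (fun x => H (‖x‖⁻¹ • x)) x :=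
        (integral_indicator hm).symm
    _ = ∫ x : ({(0)}ᶜ : Set V3), (ball (0 : V3) 1 \ ball 0 ρ).indicator (fun x => H (‖x‖⁻¹ • x)) x.1
          ∂((volume : Measure V3).comap (↑)) := by
      rw [integral_subtype_comap (measurableSet_singleton _).compl
        fun x ↦ (ball (0 : V3) 1 \ ball 0 ρ).indicator (fun x => H (‖x‖⁻¹ • x)) x,
        restrict_compl_singleton]
    _ = ∫ x : ({(0)}ᶜ : Set V3), G (homeomorphUnitSphereProd V3 x)
          ∂((volume : Measure V3).comap (↑)) := by
      congr 1; funext x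
      have hI' : (homeomorphUnitSphereProd V3 x).2 ∈ I ↔ x.1 ∈ ball (0 : V3) 1 \ ball 0 ρ := by
        simp only [I, Set.mem_sdiff, Set.mem_Iio, ← Subtype.coe_lt_coe,
          homeomorphUnitSphereProd_apply_snd_coe, mem_ball, dist_zero_right]
      by_cases hx : x.1 ∈ ball (0 : V3) 1 \ ball 0 ρ
      · simp only [G]
        rw [Set.indicator_of_mem hx, Set.indicator_of_mem (hI'.2 hx),
          homeomorphUnitSphereProd_apply_fst_coe, mul_one]
      · simp only [G]
        rw [Set.indicator_of_notMem hx, Set.indicator_of_notMem (fun h => hx (hI'.1 h)), mul_zero]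
    _ = ∫ p, G p ∂((volume : Measure V3).toSphere.prod (Measure.volumeIoiPow (Module.finrank ℝ V3 - 1))) :=
      (volume : Measure V3).measurePreserving_homeomorphUnitSphereProd.integral_comp
        (Homeomorph.measurableEmbedding _) G
    _ = (∫ w : S2, H w ∂(volume : Measure V3).toSphere) *
          ∫ s, I.indicator (fun _ => (1:ℝ)) s ∂(Measure.volumeIoiPow (Module.finrank ℝ V3 - 1)) :=
      integral_prod_mul (fun w : S2 => H w) _
    _ = _ := by
      have : Module.finrank ℝ V3 - 1 = 2 := by simp
      rw [this, integral_indicator hI, setIntegral_const, hmeas]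
      simp [mul_comm]

/-- radial cutoff -/
noncomputable def cut (ρ : ℝ) (x : V3) : ℝ := max 0 (min 1 ((1 - ρ)⁻¹ * (1 - ‖x‖)))

theorem cut_lip (ρ : ℝ) (h1 : ρ < 1) : LipschitzWith (Real.toNNReal (1 - ρ)⁻¹) (cut ρ) := by
  have h : LipschitzWith (Real.toNNReal (1 - ρ)⁻¹) (fun x : V3 => (1 - ρ)⁻¹ * (1 - ‖x‖)) := by
    refine LipschitzWith.of_dist_le_mul fun x y => ?_
    have hp : 0 < (1 - ρ)⁻¹ := inv_pos.2 (by linarith)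
    rw [Real.dist_eq, ← mul_sub, abs_mul, abs_of_pos hp, Real.coe_toNNReal _ hp.le, dist_eq_norm]
    gcongr
    have := abs_norm_sub_norm_le y x
    rw [norm_sub_rev x y]
    rwa [show 1 - ‖x‖ - (1 - ‖y‖) = ‖y‖ - ‖x‖ by ring]
  exact (h.const_min 1).const_max 0

theorem cut_supp (ρ : ℝ) (h1 : ρ < 1) (x : V3) (hx : 1 ≤ ‖x‖) : cut ρ x = 0 := by
  have hp : 0 < (1 - ρ)⁻¹ := inv_pos.2 (by linarith)
  unfold cut
  refine max_eq_left ((min_le_right _ _).trans ?_)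
  exact mul_nonpos_of_nonneg_of_nonpos hp.le (by linarith)

theorem cut_one (ρ : ℝ) (h1 : ρ < 1) (x : V3) (hx : ‖x‖ ≤ ρ) : cut ρ x = 1 := by
  have hp : 0 < 1 - ρ := by linarith
  unfold cut
  have : 1 ≤ (1 - ρ)⁻¹ * (1 - ‖x‖) := by
    rw [inv_mul_eq_div, le_div_iff₀ hp]; linarith
  rw [min_eq_left this]; simp

theorem cut_mid (ρ : ℝ) (x : V3) (hx : ρ < ‖x‖) (hx1 : ‖x‖ < 1) :
    cut ρ x = (1 - ρ)⁻¹ * (1 - ‖x‖) := by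
  have hp : 0 < 1 - ρ := by linarith
  unfold cut
  have : (1 - ρ)⁻¹ * (1 - ‖x‖) ≤ 1 := by
    rw [inv_mul_eq_div, div_le_iff₀ hp]; linarith
  rw [min_eq_right this, max_eq_right]
  exact mul_nonneg (inv_pos.2 hp).le (by linarith)

theorem cut_nonneg (ρ : ℝ) (x : V3) : 0 ≤ cut ρ x := le_max_left _ _
theorem cut_le (ρ : ℝ) (x : V3) : cut ρ x ≤ 1 := max_le zero_le_one (min_le_left _ _)

theorem lineDeriv_norm' (x v : V3) (hx : x ≠ 0) :
    HasLineDerivAt ℝ (fun x : V3 => ‖x‖) (inner ℝ (‖x‖⁻¹ • x) v) x v := by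
  unfold HasLineDerivAt
  have h1 : HasDerivAt (fun t : ℝ => x + t • v) v 0 := by
    simpa using ((hasDerivAt_id (0:ℝ)).smul_const v).const_add x
  have h2 := h1.norm_sq.sqrt (by simpa using hx)
  have e : (fun t : ℝ => √(‖x + t • v‖ ^ 2)) = fun t : ℝ => ‖x + t • v‖ := by
    funext t; exact Real.sqrt_sq (norm_nonneg _)
  rw [e] at h2
  have e2 : 2 * inner ℝ (x + (0:ℝ) • v) v / (2 * √(‖x + (0:ℝ) • v‖ ^ 2)) = inner ℝ (‖x‖⁻¹ • x) v := by
    simp [inner_smul_left]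
    field_simp
  rw [e2] at h2
  exact h2

theorem lineDeriv_cut (ρ : ℝ) (h0 : 0 < ρ) (h1 : ρ < 1) (x v : V3) (ha : ‖x‖ ≠ ρ) (hb : ‖x‖ ≠ 1) :
    lineDeriv ℝ (cut ρ) x (-v) =
      (ball (0 : V3) 1 \ ball 0 ρ).indicator (fun x => (1 - ρ)⁻¹ * inner ℝ (‖x‖⁻¹ • x) v) x := by
  rcases lt_or_gt_of_ne ha with h | h
  · rw [Set.indicator_of_notMem (by simp [h])]
    have : cut ρ =ᶠ[𝓝 x] fun _ => 1 := by
      filter_upwards [continuous_norm.continuousAt.eventually (gt_mem_nhds h)] with y hy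
      exact cut_one ρ h1 y hy.le
    rw [this.lineDeriv_eq]
    simp [lineDeriv]
  rcases lt_or_gt_of_ne hb with h' | h'
  · have hmem : x ∈ ball (0 : V3) 1 \ ball 0 ρ := by simp [h', h.le]
    rw [Set.indicator_of_mem hmem]
    have : cut ρ =ᶠ[𝓝 x] fun y => (1 - ρ)⁻¹ * (1 - ‖y‖) := by
      filter_upwards [continuous_norm.continuousAt.eventually (gt_mem_nhds h'),
        continuous_norm.continuousAt.eventually (lt_mem_nhds h)] with y hy hy'
      exact cut_mid ρ y hy' hy
    rw [this.lineDeriv_eq]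
    have hx0 : x ≠ 0 := by
      rintro rfl; simp at h; linarith
    have hd := lineDeriv_norm' x (-v) hx0
    apply HasLineDerivAt.lineDeriv
    unfold HasLineDerivAt at *
    have := (hd.const_sub 1).const_mul (1 - ρ)⁻¹
    simpa [inner_neg_right] using this
  · rw [Set.indicator_of_notMem (by simp [h'.le])]
    have : cut ρ =ᶠ[𝓝 x] fun _ => 0 := by
      filter_upwards [continuous_norm.continuousAt.eventually (lt_mem_nhds h')] with y hy
      exact cut_supp ρ h1 y hy.le
    rw [this.lineDeriv_eq]
    simp [lineDeriv]

end

section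

open MeasureTheory Complex Filter Topology Metric
open scoped ENNReal Pointwise

theorem div_lip (g : V3 → ℝ) (K : NNReal) (hg : LipschitzWith K g) (v : V3) :
    ∫ x in ball (0 : V3) 1, lineDeriv ℝ g x v =
      ∫ w : S2, inner ℝ (w : V3) v * g w ∂(volume : Measure V3).toSphere := by
  let ρ : ℕ → ℝ := fun n => 1 - 1 / ((n : ℝ) + 2)
  have hn : ∀ n : ℕ, (0:ℝ) < (n:ℝ) + 2 := fun n => by positivity
  have h0 : ∀ n, 0 < ρ n := fun n => by
    simp only [ρ]
    rw [sub_pos, div_lt_one (hn n)]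
    have : (0:ℝ) ≤ n := by positivity
    linarith
  have h1 : ∀ n, ρ n < 1 := fun n => by
    simp only [ρ]
    have := one_div_pos.2 (hn n)
    linarith
  have hρ : Tendsto ρ atTop (𝓝 1) := by
    have : Tendsto (fun n : ℕ => 1 / ((n : ℝ) + 2)) atTop (𝓝 0) := by
      have := (tendsto_const_nhds (x := (1:ℝ))).div_atTop
        (tendsto_atTop_add_const_right atTop (2:ℝ) tendsto_natCast_atTop_atTop)
      exact this
    simpa [ρ] using this.const_sub 1
  let A : ℕ → Set V3 := fun n => ball (0 : V3) 1 \ ball 0 (ρ n)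
  have hA : ∀ n, MeasurableSet (A n) := fun n => MeasurableSet.diff measurableSet_ball measurableSet_ball
  -- identity
  have hid : ∀ n, ∫ x in ball (0 : V3) 1, lineDeriv ℝ g x v * cut (ρ n) x =
      ∫ x in A n, (1 - ρ n)⁻¹ * inner ℝ (‖x‖⁻¹ • x) v * g x := by
    intro n
    have hc : HasCompactSupport (cut (ρ n)) := by
      refine HasCompactSupport.intro (isCompact_closedBall (0:V3) 1) fun x hx => cut_supp _ (h1 n) x ?_
      simp at hx; exact hx.le
    have e := LipschitzWith.integral_lineDeriv_mul_eq (μ := (volume : Measure V3)) hg (cut_lip _ (h1 n)) hc v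
    have l : ∫ x, lineDeriv ℝ g x v * cut (ρ n) x =
        ∫ x in ball (0 : V3) 1, lineDeriv ℝ g x v * cut (ρ n) x := by
      symm
      apply setIntegral_eq_integral_of_forall_compl_eq_zero
      intro x hx
      rw [cut_supp _ (h1 n) x (by simpa using hx), mul_zero]
    rw [← l, e, ← integral_indicator (hA n)]
    apply integral_congr_ae
    have n1 : ∀ᵐ x : V3, x ∉ sphere (0:V3) (ρ n) :=
      measure_eq_zero_iff_ae_notMem.1 (Measure.addHaar_sphere _ _ _)
    have n2 : ∀ᵐ x : V3, x ∉ sphere (0:V3) 1 :=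
      measure_eq_zero_iff_ae_notMem.1 (Measure.addHaar_sphere _ _ _)
    filter_upwards [n1, n2] with x hx1 hx2
    rw [lineDeriv_cut _ (h0 n) (h1 n) x v (by simpa using hx1) (by simpa using hx2)]
    by_cases hx : x ∈ A n
    · rw [Set.indicator_of_mem hx, Set.indicator_of_mem hx]
    · rw [Set.indicator_of_notMem hx, Set.indicator_of_notMem hx, zero_mul]
  -- left limit
  have hbd : ∀ x, ‖lineDeriv ℝ g x v‖ ≤ K * ‖v‖ := fun x => norm_lineDeriv_le_of_lipschitz ℝ hg
  have hL : Tendsto (fun n => ∫ x in ball (0 : V3) 1, lineDeriv ℝ g x v * cut (ρ n) x) atTop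
      (𝓝 (∫ x in ball (0 : V3) 1, lineDeriv ℝ g x v)) := by
    have hmeas := (measurable_lineDeriv (𝕜 := ℝ) (v := v) hg.continuous)
    refine tendsto_integral_of_dominated_convergence (fun _ => K * ‖v‖) ?_ ?_ ?_ ?_
    · intro n
      exact (hmeas.mul (cut_lip _ (h1 n)).continuous.measurable).aestronglyMeasurable
    · exact integrableOn_const (measure_ball_lt_top.ne)
    · intro n
      refine ae_of_all _ fun x => ?_
      rw [norm_mul, Real.norm_of_nonneg (cut_nonneg _ _)]
      calc _ ≤ (K * ‖v‖) * 1 := by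
            gcongr
            · exact cut_nonneg _ _
            · exact hbd x
            · exact cut_le _ _
        _ = _ := mul_one _
    · filter_upwards [ae_restrict_mem measurableSet_ball] with x hx
      have hx' : ‖x‖ < 1 := by simpa using hx
      refine tendsto_const_nhds.congr' ?_
      filter_upwards [hρ.eventually (lt_mem_nhds hx')] with n hn
      rw [cut_one _ (h1 n) x hn.le, mul_one]
  -- right limit
  set M := (volume : Measure V3).toSphere.real Set.univ with hM
  set J := ∫ w : S2, inner ℝ (w : V3) v * g w ∂(volume : Measure V3).toSphere with hJ
  have hvol : ∀ n, volume.real (A n) = (1 - ρ n ^ 3) / 3 * M := by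
    intro n
    have := polar_annulus (fun _ => 1) (ρ n) (h0 n) (h1 n)
    simpa [setIntegral_const, A, hM] using this
  have hfin : ∀ n, volume (A n) < ∞ := fun n =>
    (measure_mono Set.sdiff_subset).trans_lt measure_ball_lt_top
  have hdiff : ∀ n, ‖(∫ x in A n, (1 - ρ n)⁻¹ * inner ℝ (‖x‖⁻¹ • x) v * g x) -
      (1 - ρ n)⁻¹ * ((1 - ρ n ^ 3) / 3 * J)‖ ≤ (‖v‖ * K) * ((1 - ρ n ^ 3) / 3 * M) := by
    intro n
    have hp : 0 < 1 - ρ n := by linarith [h1 n]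
    have hpol := polar_annulus (fun x => inner ℝ x v * g x) (ρ n) (h0 n) (h1 n)
    have hAx : ∀ x ∈ A n, ρ n ≤ ‖x‖ ∧ ‖x‖ < 1 := by
      intro x hx
      simp only [A, Set.mem_sdiff, mem_ball, dist_zero_right, not_lt] at hx
      exact ⟨hx.2, hx.1⟩
    have hunit : ∀ x ∈ A n, ‖‖x‖⁻¹ • x‖ = 1 := by
      intro x hx
      have : 0 < ‖x‖ := (h0 n).trans_le (hAx x hx).1
      rw [norm_smul, norm_inv, norm_norm, inv_mul_cancel₀ this.ne']
    have hN : Measurable (fun x : V3 => ‖x‖⁻¹ • x) := by fun_prop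
    have hgm : Measurable g := hg.continuous.measurable
    obtain ⟨B, hB⟩ := (isCompact_closedBall (0:V3) 1).exists_bound_of_continuousOn hg.continuous.continuousOn
    have int1 : ∀ y : V3 → V3, Measurable y → (∀ x ∈ A n, ‖y x‖ ≤ 1) →
        IntegrableOn (fun x => (1 - ρ n)⁻¹ * inner ℝ (‖x‖⁻¹ • x) v * g (y x)) (A n) := by
      intro y hy hy1
      refine Measure.integrableOn_of_bounded (M := (1 - ρ n)⁻¹ * ‖v‖ * B) (hfin n).ne ?_ ?_
      · exact (((hN.inner measurable_const).const_mul _).mul (hgm.comp hy)).aestronglyMeasurable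
      · filter_upwards [ae_restrict_mem (hA n)] with x hx
        rw [norm_mul, norm_mul, Real.norm_of_nonneg (inv_pos.2 hp).le]
        have i1 : ‖(inner ℝ (‖x‖⁻¹ • x) v : ℝ)‖ ≤ ‖v‖ := by
          refine (norm_inner_le_norm _ _).trans ?_
          rw [hunit x hx, one_mul]
        have i2 := hB (y x) (by simpa using hy1 x hx)
        have : 0 ≤ (1 - ρ n)⁻¹ := (inv_pos.2 hp).le
        gcongr
    have eqq : (1 - ρ n)⁻¹ * ((1 - ρ n ^ 3) / 3 * J) =
        ∫ x in A n, (1 - ρ n)⁻¹ * inner ℝ (‖x‖⁻¹ • x) v * g (‖x‖⁻¹ • x) := by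
      rw [hJ, ← hpol, ← integral_const_mul]
      simp only [mul_assoc, A]
    have i1 := int1 (fun x => x) measurable_id (fun x hx => (hAx x hx).2.le)
    have i2 := int1 (fun x => ‖x‖⁻¹ • x) hN (fun x hx => (hunit x hx).le)
    rw [eqq, ← integral_sub i1 i2, ← hvol]
    refine norm_setIntegral_le_of_norm_le_const (hfin n) fun x hx => ?_
    rw [← mul_sub, norm_mul, norm_mul, Real.norm_of_nonneg (inv_pos.2 hp).le]
    have j1 : ‖(inner ℝ (‖x‖⁻¹ • x) v : ℝ)‖ ≤ ‖v‖ := by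
      refine (norm_inner_le_norm _ _).trans ?_
      rw [hunit x hx, one_mul]
    have j2 : ‖g x - g (‖x‖⁻¹ • x)‖ ≤ K * (1 - ρ n) := by
      refine (hg.norm_sub_le _ _).trans ?_
      gcongr
      have hx0 : 0 < ‖x‖ := (h0 n).trans_le (hAx x hx).1
      have : x - ‖x‖⁻¹ • x = (‖x‖ - 1) • (‖x‖⁻¹ • x) := by
        rw [sub_smul, one_smul, smul_smul, mul_inv_cancel₀ hx0.ne', one_smul]
      rw [this, norm_smul, hunit x hx, mul_one, Real.norm_eq_abs, abs_le]
      constructor <;> linarith [(hAx x hx).1, (hAx x hx).2]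
    have : 0 ≤ (1 - ρ n)⁻¹ := (inv_pos.2 hp).le
    calc _ ≤ (1 - ρ n)⁻¹ * ‖v‖ * (K * (1 - ρ n)) := by gcongr
      _ = _ := by field_simp
  have hmain : Tendsto (fun n => (1 - ρ n)⁻¹ * ((1 - ρ n ^ 3) / 3 * J)) atTop (𝓝 J) := by
    have e : ∀ n, (1 - ρ n)⁻¹ * ((1 - ρ n ^ 3) / 3 * J) = (1 + ρ n + ρ n ^ 2) / 3 * J := by
      intro n
      have hp : 1 - ρ n ≠ 0 := by linarith [h1 n]
      field_simp
      ring
    simp only [e]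
    have := ((((hρ.const_add 1).add (hρ.pow 2)).div_const 3).mul_const J)
    convert this using 2
    norm_num
  have hzero : Tendsto (fun n => (‖v‖ * K) * ((1 - ρ n ^ 3) / 3 * M)) atTop (𝓝 0) := by
    have := (((((hρ.pow 3).const_sub 1).div_const 3).mul_const M).const_mul (‖v‖ * K))
    simpa using this
  have hR : Tendsto (fun n => ∫ x in A n, (1 - ρ n)⁻¹ * inner ℝ (‖x‖⁻¹ • x) v * g x) atTop (𝓝 J) := by
    have := (squeeze_zero_norm hdiff hzero).add hmain
    simpa using this
  simp only [hid] at hL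
  exact tendsto_nhds_unique hL hR

theorem ball_ae_cball (c : V3) (R : ℝ) : (ball c R : Set V3) =ᵐ[volume] closedBall c R := by
  refine (ae_eq_of_subset_of_measure_ge ball_subset_closedBall ?_ measurableSet_ball.nullMeasurableSet measure_closedBall_lt_top.ne)
  rw [Measure.addHaar_closedBall_eq_addHaar_ball]

theorem div_unit (g : V3 → ℝ) (hg : ContDiffOn ℝ 1 g (closedBall 0 1)) (v : V3) :
    ∫ x in closedBall (0 : V3) 1, fderiv ℝ g x v =
      ∫ w : S2, inner ℝ (w : V3) v * g w ∂(volume : Measure V3).toSphere := by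
  obtain ⟨K, hK⟩ := hg.exists_lipschitzOnWith one_ne_zero (convex_closedBall _ _) (isCompact_closedBall _ _)
  obtain ⟨G, hG, hGg⟩ := hK.extend_real
  have h := div_lip G K hG v
  have e2 : ∀ w : S2, G w = g w := fun w => (hGg (sphere_subset_closedBall w.2)).symm
  simp only [e2] at h
  rw [← h, setIntegral_congr_set (ball_ae_cball _ _).symm]
  refine setIntegral_congr_fun measurableSet_ball fun x hx => ?_
  have hn : closedBall (0:V3) 1 ∈ 𝓝 x := mem_of_superset (isOpen_ball.mem_nhds hx) ball_subset_closedBall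
  have hd : DifferentiableAt ℝ g x := (hg.contDiffAt hn).differentiableAt one_ne_zero
  have he : G =ᶠ[𝓝 x] g := by
    filter_upwards [hn] with y hy using (hGg hy).symm
  show fderiv ℝ g x v = lineDeriv ℝ G x v
  rw [he.lineDeriv_eq, hd.lineDeriv_eq_fderiv]

end

section

open MeasureTheory Complex Filter Topology Metric
open scoped ENNReal Pointwise

theorem sphere_int {F : Type} [NormedAddCommGroup F] [NormedSpace ℝ F] (H : V3 → F) (c : V3) (R : ℝ) (hR : 0 < R) :
    ∫ x in sphere c R, H x ∂μH[2] = R ^ 2 • ∫ w : S2, H (c + R • (w : V3)) ∂μH[2] := by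
  let e : V3 ≃ₜ V3 := (Homeomorph.smulOfNeZero R hR.ne').trans (Homeomorph.addLeft c)
  have he : ∀ x, e x = c + R • x := fun x => rfl
  have hpre : e ⁻¹' (sphere c R) = sphere (0 : V3) 1 := by
    ext x
    simp [he, norm_smul, abs_of_pos hR, hR.ne']
  have hm : (μH[2] : Measure V3) = ENNReal.ofReal (R ^ 2) • (μH[2] : Measure V3).map e := by
    ext s hs
    rw [Measure.smul_apply, Measure.map_apply e.continuous.measurable hs]
    have h1 : s = e '' (e ⁻¹' s) := by rw [Set.image_preimage_eq _ e.surjective]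
    have h2 : e '' (e ⁻¹' s) = (fun x => c + x) '' (R • (e ⁻¹' s)) := by
      rw [← Set.image_smul, Set.image_image]
      rfl
    conv_lhs => rw [h1, h2]
    rw [(isometry_add_left c).hausdorffMeasure_image (Or.inl (by norm_num)),
      Measure.hausdorffMeasure_smul₀ (by norm_num) hR.ne']
    rw [ENNReal.smul_def, smul_eq_mul, smul_eq_mul]
    congr 1
    rw [ENNReal.ofReal, Real.toNNReal_pow hR.le]
    congr 1
    rw [show (2:ℝ) = ((2:ℕ):ℝ) by norm_num, NNReal.rpow_natCast]
    congr 1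
    ext; simp [abs_of_pos hR, hR.le]
  have hv : (μH[2] : Measure S2).map (Subtype.val : S2 → V3) = (μH[2] : Measure V3).restrict (sphere 0 1) := by
    rw [(isometry_subtype_coe).map_hausdorffMeasure (Or.inl (by norm_num)), Subtype.range_coe]
  have hme : MeasurableEmbedding (Subtype.val : S2 → V3) :=
    MeasurableEmbedding.subtype_coe isClosed_sphere.measurableSet
  rw [hm, Measure.restrict_smul, integral_smul_measure,
    e.measurableEmbedding.setIntegral_map, hpre]
  rw [← hv, hme.integral_map, ENNReal.toReal_ofReal (by positivity)]
  simp only [he]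

theorem exists_div_scaled : ∃ κ : ℝ, ∀ (R : ℝ), 0 < R → ∀ (h : V3 → ℝ), ContDiffOn ℝ 1 h (closedBall 0 R) →
    ∀ i : Fin 3, ∫ y in closedBall (0:V3) R, fderiv ℝ h y (EuclideanSpace.single i 1) =
      κ * (R ^ 2 * ∫ w : S2, (w : V3) i * h (R • (w : V3)) ∂μH[2]) := by
  obtain ⟨κ, hκ, hS⟩ := exists_sphere_const
  refine ⟨κ.toReal, fun R hR h hh i => ?_⟩
  have hmaps : Set.MapsTo (fun y : V3 => R • y) (closedBall 0 1) (closedBall 0 R) := by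
    intro y hy
    simp only [mem_closedBall, dist_zero_right, norm_smul, Real.norm_eq_abs, abs_of_pos hR] at *
    nlinarith
  have hc : ContDiffOn ℝ 1 (fun y : V3 => h (R • y)) (closedBall 0 1) :=
    hh.comp (by fun_prop) hmaps
  have hd := div_unit _ hc (EuclideanSpace.single i 1)
  rw [hS, integral_smul_measure] at hd
  have hL : ∫ y in closedBall (0:V3) 1, fderiv ℝ (fun y : V3 => h (R • y)) y (EuclideanSpace.single i 1)
      = (R ^ 2)⁻¹ * ∫ y in closedBall (0:V3) R, fderiv ℝ h y (EuclideanSpace.single i 1) := by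
    have e1 : ∀ y : V3, fderiv ℝ (fun y : V3 => h (R • y)) y (EuclideanSpace.single i 1) =
       R * fderiv ℝ h (R • y) (EuclideanSpace.single i 1) := by
      intro y
      rw [fderiv_comp_smul]
      rfl
    simp only [e1]
    rw [integral_const_mul, Measure.setIntegral_comp_smul_of_pos volume (fun y => fderiv ℝ h y (EuclideanSpace.single i 1)) _ hR]
    rw [_root_.smul_closedBall _ _ zero_le_one]
    simp [abs_of_pos hR]
    field_simp
  rw [hL] at hd
  have : ∀ w : S2, (inner ℝ (w:V3) (EuclideanSpace.single i 1) : ℝ) = (w:V3) i := by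
    intro w
    simp [PiLp.inner_apply]
  simp only [this, smul_eq_mul] at hd
  field_simp at hd
  linarith

end

section

open MeasureTheory Complex Filter Topology Metric
open scoped ENNReal Pointwise

theorem int_prod_aux {E : Type} [NormedAddCommGroup E] [NormedSpace ℝ E] {X : Type} [TopologicalSpace X] [T2Space X] [SecondCountableTopology X] [MeasurableSpace X] [BorelSpace X]
    (μ : Measure X) [SFinite μ] [IsFiniteMeasureOnCompacts μ] (k : Set X) (hk : IsCompact k) (a b : ℝ)
    (F : ℝ × X → E) (hF : ContinuousOn F (Set.Icc a b ×ˢ k)) :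
    Integrable F ((volume.restrict (Set.Icc a b)).prod (μ.restrict k)) := by
  rw [Measure.prod_restrict]
  exact hF.integrableOn_compact' (isCompact_Icc.prod hk)
    (measurableSet_Icc.prod hk.isClosed.measurableSet)

theorem ii_aux {E : Type} [NormedAddCommGroup E] [NormedSpace ℝ E] {X : Type} [TopologicalSpace X] [T2Space X] [SecondCountableTopology X] [MeasurableSpace X] [BorelSpace X]
    (μ : Measure X) [SFinite μ] [IsFiniteMeasureOnCompacts μ] (k : Set X) (hk : IsCompact k) (a b : ℝ)
    (F : ℝ × X → E) (hF : ContinuousOn F (Set.Icc a b ×ˢ k)) (s t : ℝ) (hs : s ∈ Set.Icc a b) (ht : t ∈ Set.Icc a b) :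
    IntervalIntegrable (fun t' => ∫ x in k, F (t', x) ∂μ) volume s t := by
  have h : IntegrableOn (fun t' => ∫ x in k, F (t', x) ∂μ) (Set.Icc a b) :=
    (int_prod_aux μ k hk a b F hF).integral_prod_left
  exact (h.mono_set (Set.uIcc_subset_Icc hs ht)).intervalIntegrable

theorem swap_aux {X : Type} [TopologicalSpace X] [T2Space X] [SecondCountableTopology X] [MeasurableSpace X] [BorelSpace X]
    (μ : Measure X) [SFinite μ] [IsFiniteMeasureOnCompacts μ] (k : Set X) (hk : IsCompact k) (a b : ℝ)
    (F : ℝ × X → ℝ) (hF : ContinuousOn F (Set.Icc a b ×ˢ k)) (s t : ℝ) (hs : s ∈ Set.Icc a b) (ht : t ∈ Set.Icc a b) :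
    ∫ x in k, (∫ t' in s..t, F (t', x)) ∂μ = ∫ t' in s..t, ∫ x in k, F (t', x) ∂μ := by
  simp only [intervalIntegral.intervalIntegral_eq_integral_uIoc]
  rw [integral_smul]
  congr 1
  refine integral_integral_swap (f := fun x t' => F (t', x)) ?_
  refine Integrable.swap (f := F) ?_
  have h := int_prod_aux μ k hk a b F hF
  rw [Measure.prod_restrict] at h ⊢
  exact IntegrableOn.mono_set h (Set.prod_mono (Set.uIoc_subset_uIcc.trans (Set.uIcc_subset_Icc hs ht)) subset_rfl)

theorem flat (κ : ℝ) (hκ : ∀ (R : ℝ), 0 < R → ∀ (h : V3 → ℝ), ContDiffOn ℝ 1 h (closedBall 0 R) →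
    ∀ i : Fin 3, ∫ y in closedBall (0:V3) R, fderiv ℝ h y (EuclideanSpace.single i 1) =
      κ * (R ^ 2 * ∫ w : S2, (w : V3) i * h (R • (w : V3)) ∂μH[2]))
    (a b : ℝ) (hab : a < b) (R : ℝ) (hR : 0 < R) (g φ : ℝ × V3 → ℝ) (H : Fin 3 → ℝ × V3 → ℝ)
    (hg : ContDiffOn ℝ 1 g (Set.Icc a b ×ˢ closedBall 0 R))
    (hH : ∀ i, ContDiffOn ℝ 1 (H i) (Set.Icc a b ×ˢ closedBall 0 R))
    (hφ : ContinuousOn φ (Set.Icc a b ×ˢ closedBall 0 R))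
    (heq : ∀ t ∈ Set.Ioo a b, ∀ y ∈ ball (0:V3) R, fderiv ℝ g (t, y) (1, 0) +
      ∑ i, fderiv ℝ (H i) (t, y) (0, EuclideanSpace.single i 1) = φ (t, y))
    (s t : ℝ) (hs : s ∈ Set.Icc a b) (ht : t ∈ Set.Icc a b) :
    (∫ y in closedBall (0:V3) R, g (t, y)) - ∫ y in closedBall (0:V3) R, g (s, y) =
      ∫ t' in s..t, ((∫ y in closedBall (0:V3) R, φ (t', y)) -
        ∑ i, κ * (R ^ 2 * ∫ w : S2, (w : V3) i * H i (t', R • (w : V3)) ∂μH[2])) := by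
  set B := closedBall (0:V3) R with hB
  set K := Set.Icc a b ×ˢ B with hK
  have hBc : IsCompact B := isCompact_closedBall _ _
  have hUD : UniqueDiffOn ℝ K :=
    (uniqueDiffOn_Icc hab).prod (uniqueDiffOn_convex (convex_closedBall _ _)
      ⟨0, mem_interior_iff_mem_nhds.2 (closedBall_mem_nhds _ hR)⟩)
  have hnhds : ∀ t ∈ Set.Ioo a b, ∀ y ∈ ball (0:V3) R, K ∈ 𝓝 (t, y) := by
    intro t ht y hy
    exact prod_mem_nhds (Icc_mem_nhds ht.1 ht.2)
      (mem_of_superset (isOpen_ball.mem_nhds hy) ball_subset_closedBall)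
  let E : Fin 3 → ℝ × V3 → ℝ := fun i q => fderivWithin ℝ (H i) K q (0, EuclideanSpace.single i 1)
  have hE : ∀ i, ContinuousOn (E i) K := fun i =>
    ((hH i).continuousOn_fderivWithin hUD le_rfl).clm_apply continuousOn_const
  let D : ℝ × V3 → ℝ := fun q => φ q - ∑ i, E i q
  have hD : ContinuousOn D K := hφ.sub (continuousOn_finsetSum _ fun i _ => hE i)
  have hslice : ∀ (F : ℝ × V3 → ℝ), ContinuousOn F K → ∀ t ∈ Set.Icc a b,
      IntegrableOn (fun y => F (t, y)) B := by
    intro F hF t ht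
    have : ContinuousOn (fun y => F (t, y)) B :=
      hF.comp (f := fun y : V3 => (t, y)) (by fun_prop) (fun y hy => ⟨ht, hy⟩)
    exact this.integrableOn_compact hBc
  rw [← integral_sub (hslice g hg.continuousOn t ht) (hslice g hg.continuousOn s hs)]
  have h1 : ∫ y in B, (g (t, y) - g (s, y)) = ∫ y in B, ∫ t' in s..t, D (t', y) := by
    rw [hB, ← setIntegral_congr_set (ball_ae_cball 0 R), ← setIntegral_congr_set (ball_ae_cball 0 R)]
    refine setIntegral_congr_fun measurableSet_ball fun y hy => ?_
    have hyB : y ∈ B := ball_subset_closedBall hy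
    have hsub := Set.uIcc_subset_Icc hs ht
    refine (intervalIntegral.integral_eq_sub_of_hasDeriv_right (f := fun t' => g (t', y)) ?_ ?_ ?_).symm
    · exact hg.continuousOn.comp (f := fun t' : ℝ => (t', y)) (by fun_prop) (fun t' ht' => ⟨hsub ht', hyB⟩)
    · intro x hx
      have hx' : x ∈ Set.Ioo a b := by
        constructor
        · exact lt_of_le_of_lt (le_min hs.1 ht.1) hx.1
        · exact lt_of_lt_of_le hx.2 (max_le hs.2 ht.2)
      have hn := hnhds x hx' y hy
      have hd : HasFDerivAt g (fderiv ℝ g (x, y)) (x, y) :=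
        ((hg.contDiffAt hn).differentiableAt one_ne_zero).hasFDerivAt
      have hc : HasDerivAt (fun t' : ℝ => (t', y)) ((1 : ℝ), (0 : V3)) x :=
        (hasDerivAt_id x).prodMk (hasDerivAt_const x y)
      have hh := (hd.comp_hasDerivAt x hc).hasDerivWithinAt (s := Set.Ioi x)
      have hDv : D (x, y) = fderiv ℝ g (x, y) (1, 0) := by
        have := heq x hx' y hy
        simp only [D, E, fderivWithin_of_mem_nhds hn]
        exact sub_eq_of_eq_add this.symm
      show HasDerivWithinAt (fun t' => g (t', y)) (D (x, y)) (Set.Ioi x) x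
      rw [hDv]
      exact hh
    · refine ContinuousOn.intervalIntegrable ?_
      exact hD.comp (f := fun t' : ℝ => (t', y)) (by fun_prop) (fun t' ht' => ⟨hsub ht', hyB⟩)
  rw [h1, swap_aux volume B hBc a b D hD s t hs ht]
  refine intervalIntegral.integral_congr_uIoo fun x hx => ?_
  have hx' : x ∈ Set.Ioo a b := by
    constructor
    · exact lt_of_le_of_lt (le_min hs.1 ht.1) hx.1
    · exact lt_of_lt_of_le hx.2 (max_le hs.2 ht.2)
  have hxI := Set.Ioo_subset_Icc_self hx'
  show ∫ y in B, (φ (x, y) - ∑ i, E i (x, y)) = _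
  rw [integral_sub (hslice φ hφ x hxI) (integrable_finsetSum _ fun i _ => hslice _ (hE i) x hxI),
    integral_finsetSum _ fun i _ => hslice _ (hE i) x hxI]
  congr 1
  refine Finset.sum_congr rfl fun i _ => ?_
  rw [← hκ R hR (fun y => H i (x, y)) ((hH i).comp (f := fun y : V3 => (x, y)) (by fun_prop) (fun y hy => ⟨hxI, hy⟩)) i]
  rw [hB, ← setIntegral_congr_set (ball_ae_cball 0 R), ← setIntegral_congr_set (ball_ae_cball 0 R)]
  refine setIntegral_congr_fun measurableSet_ball fun y hy => ?_
  have hn := hnhds x hx' y hy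
  have hd : HasFDerivAt (H i) (fderiv ℝ (H i) (x, y)) (x, y) :=
    (((hH i).contDiffAt hn).differentiableAt one_ne_zero).hasFDerivAt
  have hc : HasFDerivAt (fun y : V3 => (x, y)) (ContinuousLinearMap.inr ℝ ℝ V3) y :=
    hasFDerivAt_prodMk_right x y
  have hh := (hd.comp y hc).fderiv
  have hh' : fderiv ℝ (fun y => H i (x, y)) y = (fderiv ℝ (H i) (x, y)).comp (ContinuousLinearMap.inr ℝ ℝ V3) := hh
  simp only [E, fderivWithin_of_mem_nhds hn, hh']
  simp

end

section

open MeasureTheory Complex Filter Topology Metric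
open scoped ENNReal Pointwise

theorem ball_shift {E : Type} [NormedAddCommGroup E] [NormedSpace ℝ E] (F : V3 → E) (c : V3) (R : ℝ) :
    ∫ x in closedBall c R, F x = ∫ y in closedBall (0:V3) R, F (c + y) := by
  have h := (measurePreserving_add_left (volume : Measure V3) c).setIntegral_preimage_emb
    (measurableEmbedding_addLeft c) F (closedBall c R)
  rw [← h]
  congr 2
  ext y
  simp

theorem nrm_shift (c : V3) (R : ℝ) (hR : 0 < R) (w : V3) (i : Fin 3) : nrm c R (c + R • w) i = w i := by
  simp [nrm, hR.ne']

theorem maps_ball (a b : ℝ) (r : ℝ → V3) (R : ℝ) :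
    Set.MapsTo (fun q : ℝ × V3 => (q.1, r q.1 + q.2)) (Set.Icc a b ×ˢ closedBall 0 R) (Tube a b r R) := by
  rintro ⟨t, y⟩ ⟨ht, hy⟩
  refine ⟨ht, ?_⟩
  simpa using hy

theorem maps_sph (a b : ℝ) (r : ℝ → V3) (R : ℝ) (hR : 0 < R) :
    Set.MapsTo (fun q : ℝ × S2 => (q.1, r q.1 + R • (q.2 : V3))) (Set.Icc a b ×ˢ Set.univ) (Tube a b r R) := by
  rintro ⟨t, y⟩ ⟨ht, -⟩
  refine ⟨ht, ?_⟩
  have : ‖(y:V3)‖ = 1 := by simp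
  simp [norm_smul, this, abs_of_pos hR]

theorem ii_ball {E : Type} [NormedAddCommGroup E] [NormedSpace ℝ E] (a b : ℝ) (r : ℝ → V3) (hr : Continuous r)
    (R : ℝ) (F : ℝ × V3 → E) (hF : ContinuousOn F (Tube a b r R))
    (s t : ℝ) (hs : s ∈ Set.Icc a b) (ht : t ∈ Set.Icc a b) :
    IntervalIntegrable (fun t' => ∫ x in closedBall (r t') R, F (t', x)) volume s t := by
  have he : (fun t' => ∫ x in closedBall (r t') R, F (t', x)) =
      fun t' => ∫ y in closedBall (0:V3) R, F (t', r t' + y) := by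
    ext t'
    exact ball_shift _ _ _
  rw [he]
  exact ii_aux volume (closedBall 0 R) (isCompact_closedBall _ _) a b (fun q => F (q.1, r q.1 + q.2))
    (hF.comp (f := fun q : ℝ × V3 => (q.1, r q.1 + q.2)) (by fun_prop) (maps_ball a b r R)) s t hs ht

theorem ii_sph {E : Type} [NormedAddCommGroup E] [NormedSpace ℝ E] (a b : ℝ) (r : ℝ → V3) (hr : Continuous r)
    (R : ℝ) (hR : 0 < R) (F : ℝ × V3 → E) (hF : ContinuousOn F (Tube a b r R))
    (s t : ℝ) (hs : s ∈ Set.Icc a b) (ht : t ∈ Set.Icc a b) :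
    IntervalIntegrable (fun t' => ∫ x in sphere (r t') R, F (t', x) ∂μH[2]) volume s t := by
  have h := ii_aux (μH[2] : Measure S2) Set.univ isCompact_univ a b (fun q => F (q.1, r q.1 + R • (q.2 : V3)))
    (hF.comp (f := fun q : ℝ × S2 => (q.1, r q.1 + R • (q.2 : V3))) (by fun_prop) (maps_sph a b r R hR)) s t hs ht
  simp only [Measure.restrict_univ] at h
  have he : (fun t' => ∫ x in sphere (r t') R, F (t', x) ∂μH[2]) =
      fun t' => R ^ 2 • ∫ w : S2, F (t', r t' + R • (w : V3)) ∂μH[2] := by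
    ext t'
    exact sphere_int (fun x => F (t', x)) (r t') R hR
  rw [he]
  exact ⟨h.1.smul (R ^ 2), h.2.smul (R ^ 2)⟩

theorem sph_slice {E : Type} [NormedAddCommGroup E] [NormedSpace ℝ E] (a b : ℝ) (r : ℝ → V3)
    (R : ℝ) (hR : 0 < R) (F : ℝ × V3 → E) (hF : ContinuousOn F (Tube a b r R))
    (t : ℝ) (ht : t ∈ Set.Icc a b) :
    Integrable (fun w : S2 => F (t, r t + R • (w : V3))) μH[2] := by
  have : Continuous (fun w : S2 => F (t, r t + R • (w : V3))) :=
    hF.comp_continuous (f := fun w : S2 => (t, r t + R • (w : V3))) (by fun_prop)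
      (fun w => maps_sph a b r R hR (x := (t, w)) ⟨ht, trivial⟩)
  have h := this.continuousOn.integrableOn_compact (μ := (μH[2] : Measure S2)) isCompact_univ
  simpa using h

theorem ball_slice {E : Type} [NormedAddCommGroup E] [NormedSpace ℝ E] (a b : ℝ) (r : ℝ → V3)
    (R : ℝ) (F : ℝ × V3 → E) (hF : ContinuousOn F (Tube a b r R))
    (t : ℝ) (ht : t ∈ Set.Icc a b) :
    IntegrableOn (fun x => F (t, x)) (closedBall (r t) R) := by
  have : ContinuousOn (fun x => F (t, x)) (closedBall (r t) R) :=
    hF.comp (f := fun x : V3 => (t, x)) (by fun_prop)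
      (fun x hx => ⟨ht, by simpa [dist_eq_norm] using hx⟩)
  exact this.integrableOn_compact (isCompact_closedBall _ _)

theorem ball_eval (a b : ℝ) (r : ℝ → V3)
    (R : ℝ) (F : ℝ × V3 → Fin 3 → ℝ) (hF : ContinuousOn F (Tube a b r R))
    (t : ℝ) (ht : t ∈ Set.Icc a b) (j : Fin 3) :
    (∫ x in closedBall (r t) R, F (t, x)) j = ∫ x in closedBall (r t) R, F (t, x) j := by
  refine eval_integral (fun i => ?_) j
  exact ball_slice a b r R (fun q => F q i) ((continuous_apply i).comp_continuousOn hF) t ht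

theorem sph_eval (a b : ℝ) (r : ℝ → V3)
    (R : ℝ) (hR : 0 < R) (F : ℝ × V3 → Fin 3 → ℝ) (hF : ContinuousOn F (Tube a b r R))
    (t : ℝ) (ht : t ∈ Set.Icc a b) (j : Fin 3) :
    (∫ x in sphere (r t) R, F (t, x) ∂μH[2]) j = ∫ x in sphere (r t) R, F (t, x) j ∂μH[2] := by
  rw [sphere_int _ _ R hR, sphere_int _ _ R hR]
  rw [Pi.smul_apply]
  congr 1
  refine eval_integral (fun i => ?_) j
  exact sph_slice a b r R hR (fun q => F q i) ((continuous_apply i).comp_continuousOn hF) t ht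

theorem ii_eval (G : ℝ → Fin 3 → ℝ) (s t : ℝ) (h : IntervalIntegrable G volume s t) (j : Fin 3) :
    (∫ t' in s..t, G t') j = ∫ t' in s..t, G t' j :=
  ((ContinuousLinearMap.proj (R := ℝ) (φ := fun _ : Fin 3 => ℝ) j).intervalIntegral_comp_comm h).symm

theorem moving (κ : ℝ) (hκ : ∀ (R : ℝ), 0 < R → ∀ (h : V3 → ℝ), ContDiffOn ℝ 1 h (closedBall 0 R) →
    ∀ i : Fin 3, ∫ y in closedBall (0:V3) R, fderiv ℝ h y (EuclideanSpace.single i 1) =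
      κ * (R ^ 2 * ∫ w : S2, (w : V3) i * h (R • (w : V3)) ∂μH[2]))
    (a b : ℝ) (hab : a < b) (R : ℝ) (hR : 0 < R) (r : ℝ → V3) (hr : ContDiff ℝ 2 r)
    (p φ : ℝ × V3 → ℝ) (τ : Fin 3 → ℝ × V3 → ℝ)
    (hp : ContDiffOn ℝ 1 p (Tube a b r R))
    (hτ : ∀ i, ContDiffOn ℝ 1 (τ i) (Tube a b r R))
    (hφ : ContinuousOn φ (Tube a b r R))
    (hmom : ∀ q ∈ Tube a b r R, ptD p q + ∑ i, pxD i (τ i) q = φ q)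
    (s t : ℝ) (hs : s ∈ Set.Icc a b) (ht : t ∈ Set.Icc a b) :
    (∫ x in closedBall (r t) R, p (t, x)) - ∫ x in closedBall (r s) R, p (s, x) =
      (∫ t' in s..t, ∫ x in closedBall (r t') R, φ (t', x))
      - κ * (∫ t' in s..t, ∫ x in sphere (r t') R, ∑ i, nrm (r t') R x i * τ i (t', x) ∂μH[2])
      + κ * (∫ t' in s..t, ∫ x in sphere (r t') R,
          dot3 (fun i => deriv r t' i) (nrm (r t') R x) * p (t', x) ∂μH[2]) := by
  have hr1 : ContDiff ℝ 1 r := hr.of_le (by norm_num)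
  have hu : ContDiff ℝ 1 (deriv r) := ((contDiff_succ_iff_deriv (n := 1)).1 (by rw [one_add_one_eq_two]; exact hr)).2.2
  have hui : ∀ i, ContDiff ℝ 1 (fun t => deriv r t i) := fun i => by fun_prop
  let Φ : ℝ × V3 → ℝ × V3 := fun q => (q.1, r q.1 + q.2)
  have hΦ : ContDiff ℝ 1 Φ := by
    have : ContDiff ℝ 1 (fun q : ℝ × V3 => r q.1) := hr1.comp contDiff_fst
    exact contDiff_fst.prodMk (this.add contDiff_snd)
  let H : Fin 3 → ℝ × V3 → ℝ := fun i q => τ i (Φ q) - deriv r q.1 i * p (Φ q)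
  have hg : ContDiffOn ℝ 1 (fun q => p (Φ q)) (Set.Icc a b ×ˢ closedBall 0 R) :=
    hp.comp hΦ.contDiffOn (maps_ball a b r R)
  have hui' : ∀ i, ContDiff ℝ 1 (fun q : ℝ × V3 => deriv r q.1 i) := fun i => (hui i).comp contDiff_fst
  have hH : ∀ i, ContDiffOn ℝ 1 (H i) (Set.Icc a b ×ˢ closedBall 0 R) := fun i =>
    ((hτ i).comp hΦ.contDiffOn (maps_ball a b r R)).sub ((hui' i).contDiffOn.mul hg)
  have hfl := flat κ hκ a b hab R hR (fun q => p (Φ q)) (fun q => φ (Φ q)) H hg hH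
    (hφ.comp hΦ.continuous.continuousOn (maps_ball a b r R)) ?_ s t hs ht
  · have e1 : ∀ t, ∫ x in closedBall (r t) R, p (t, x) = ∫ y in closedBall (0:V3) R, p (Φ (t, y)) :=
      fun t => ball_shift _ _ _
    rw [e1, e1, hfl]
    have c0 : ContinuousOn (fun q : ℝ × V3 => fun i => nrm (r q.1) R q.2 i) (Tube a b r R) := by
      have := hr1.continuous
      simp only [nrm]
      fun_prop
    have c0i : ∀ i, ContinuousOn (fun q : ℝ × V3 => nrm (r q.1) R q.2 i) (Tube a b r R) :=
      fun i => (continuous_apply i).comp_continuousOn c0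
    have c1 : ContinuousOn (fun q : ℝ × V3 => ∑ i, nrm (r q.1) R q.2 i * τ i q) (Tube a b r R) :=
      continuousOn_finsetSum _ fun i _ => (c0i i).mul (hτ i).continuousOn
    have c2 : ContinuousOn (fun q : ℝ × V3 => dot3 (fun i => deriv r q.1 i) (nrm (r q.1) R q.2) * p q) (Tube a b r R) := by
      refine ContinuousOn.mul ?_ hp.continuousOn
      exact continuousOn_finsetSum _ fun i _ => (hui' i).continuous.continuousOn.mul (c0i i)
    have i0 := ii_ball a b r hr1.continuous R φ hφ s t hs ht
    have i1 := ii_sph a b r hr1.continuous R hR _ c1 s t hs ht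
    have i2 := ii_sph a b r hr1.continuous R hR _ c2 s t hs ht
    rw [← intervalIntegral.integral_const_mul, ← intervalIntegral.integral_const_mul,
      ← intervalIntegral.integral_sub i0 (i1.const_mul κ),
      ← intervalIntegral.integral_add (i0.sub (i1.const_mul κ)) (i2.const_mul κ)]
    refine intervalIntegral.integral_congr fun t' ht' => ?_
    have ht'' : t' ∈ Set.Icc a b := Set.uIcc_subset_Icc hs ht ht'
    have d0 : ∫ x in closedBall (r t') R, φ (t', x) = ∫ y in closedBall (0:V3) R, φ (Φ (t', y)) :=
      ball_shift _ _ _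
    have j1 := fun i => sph_slice a b r R hR (fun q => nrm (r q.1) R q.2 i * τ i q) ((c0i i).mul (hτ i).continuousOn) t' ht''
    have j2 := fun i => sph_slice a b r R hR (fun q => deriv r q.1 i * nrm (r q.1) R q.2 i * p q)
      (((hui' i).continuous.continuousOn.mul (c0i i)).mul hp.continuousOn) t' ht''
    simp only [nrm_shift _ _ hR] at j1 j2
    have d1 : ∫ x in sphere (r t') R, ∑ i, nrm (r t') R x i * τ i (t', x) ∂μH[2] =
        R ^ 2 * ∑ i, ∫ w : S2, (w:V3) i * τ i (Φ (t', R • (w:V3))) ∂μH[2] := by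
      rw [sphere_int _ _ R hR, smul_eq_mul]
      simp only [nrm_shift _ _ hR]
      rw [integral_finsetSum _ fun i _ => j1 i]
    have d2 : ∫ x in sphere (r t') R, dot3 (fun i => deriv r t' i) (nrm (r t') R x) * p (t', x) ∂μH[2] =
        R ^ 2 * ∑ i, ∫ w : S2, deriv r t' i * (w:V3) i * p (Φ (t', R • (w:V3))) ∂μH[2] := by
      rw [sphere_int _ _ R hR, smul_eq_mul]
      simp only [dot3, nrm_shift _ _ hR, Finset.sum_mul]
      rw [integral_finsetSum _ fun i _ => j2 i]
    have d3 : ∀ i, ∫ w : S2, (w:V3) i * H i (t', R • (w:V3)) ∂μH[2] =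
        (∫ w : S2, (w:V3) i * τ i (Φ (t', R • (w:V3))) ∂μH[2]) -
          ∫ w : S2, deriv r t' i * (w:V3) i * p (Φ (t', R • (w:V3))) ∂μH[2] := by
      intro i
      rw [← integral_sub (j1 i) (j2 i)]
      congr 1
      ext w
      simp only [H, Φ]
      ring
    simp only [d0, d1, d2, d3, Finset.mul_sum, mul_sub, Finset.sum_sub_distrib]
    ring
  · intro t ht y hy
    have hT : Tube a b r R ∈ 𝓝 (Φ (t, y)) := by
      have ho : IsOpen {q : ℝ × V3 | q.1 ∈ Set.Ioo a b ∧ ‖q.2 - r q.1‖ < R} := by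
        have := hr1.continuous
        refine IsOpen.and (isOpen_Ioo.preimage continuous_fst) ?_
        exact isOpen_lt (by fun_prop) continuous_const
      refine mem_of_superset (ho.mem_nhds ⟨ht, by simpa [Φ] using hy⟩) ?_
      rintro q ⟨h1, h2⟩
      exact ⟨Set.Ioo_subset_Icc_self h1, h2.le⟩
    have hq : Φ (t, y) ∈ Tube a b r R := mem_of_mem_nhds hT
    have dp := ((hp.contDiffAt hT).differentiableAt one_ne_zero).hasFDerivAt
    have dτ := fun i => (((hτ i).contDiffAt hT).differentiableAt one_ne_zero).hasFDerivAt
    have dr : HasFDerivAt r (fderiv ℝ r t) t := (hr1.differentiable one_ne_zero t).hasFDerivAt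
    have dfst : HasFDerivAt (fun q : ℝ × V3 => q.1) (ContinuousLinearMap.fst ℝ ℝ V3) (t, y) := hasFDerivAt_fst
    have dsnd : HasFDerivAt (fun q : ℝ × V3 => q.2) (ContinuousLinearMap.snd ℝ ℝ V3) (t, y) := hasFDerivAt_snd
    have dΦ : HasFDerivAt Φ ((ContinuousLinearMap.fst ℝ ℝ V3).prod
        ((fderiv ℝ r t).comp (ContinuousLinearMap.fst ℝ ℝ V3) + ContinuousLinearMap.snd ℝ ℝ V3)) (t, y) :=
      dfst.prodMk ((HasFDerivAt.comp (t, y) dr dfst).add dsnd)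
    have du := fun i => (((hui i).differentiable one_ne_zero t).hasFDerivAt)
    have du' : ∀ i, HasFDerivAt (fun q : ℝ × V3 => deriv r q.1 i)
        ((fderiv ℝ (fun t => deriv r t i) t).comp (ContinuousLinearMap.fst ℝ ℝ V3)) (t, y) := fun i =>
      HasFDerivAt.comp (t, y) (g := fun t => deriv r t i) (du i) dfst
    have dg : HasFDerivAt (fun q => p (Φ q)) _ (t, y) := HasFDerivAt.comp (t, y) dp dΦ
    have dH : ∀ i, HasFDerivAt (H i) _ (t, y) := fun i => (HasFDerivAt.comp (t, y) (dτ i) dΦ).sub ((du' i).mul dg)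
    have f1 : fderiv ℝ (fun q => p (Φ q)) (t, y) (1, 0) = ptD p (Φ (t, y)) + ∑ i, deriv r t i * pxD i p (Φ (t, y)) := by
      rw [dg.fderiv]
      have hv : ((1 : ℝ), deriv r t) = (1, 0) + ∑ i, deriv r t i • ((0 : ℝ), (EuclideanSpace.single i 1 : V3)) := by
        simp only [Fin.sum_univ_three]
        ext k
        · simp
        · fin_cases k <;> simp
      have : (fderiv ℝ p (Φ (t, y))) (1, deriv r t) = ptD p (Φ (t, y)) + ∑ i, deriv r t i * pxD i p (Φ (t, y)) := by
        rw [hv, map_add, map_sum]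
        simp only [map_smul, smul_eq_mul, ptD, pxD]
      simpa using this
    have f2 : ∀ i, fderiv ℝ (H i) (t, y) (0, EuclideanSpace.single i 1) =
        pxD i (τ i) (Φ (t, y)) - deriv r t i * pxD i p (Φ (t, y)) := by
      intro i
      rw [(dH i).fderiv]
      simp [pxD]
    have := hmom _ hq
    simp only [f1, f2, Finset.sum_sub_distrib]
    linarith

end

section

open MeasureTheory Complex Filter Topology Metric
open scoped ENNReal Pointwise

theorem key_vec (κ : ℝ) (hκ : ∀ (R : ℝ), 0 < R → ∀ (h : V3 → ℝ), ContDiffOn ℝ 1 h (closedBall 0 R) →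
    ∀ i : Fin 3, ∫ y in closedBall (0:V3) R, fderiv ℝ h y (EuclideanSpace.single i 1) =
      κ * (R ^ 2 * ∫ w : S2, (w : V3) i * h (R • (w : V3)) ∂μH[2]))
    (a b : ℝ) (R : ℝ) (hR : 0 < R) (r : ℝ → V3) (hr : ContDiff ℝ 2 r)
    (P f : ℝ × V3 → Fin 3 → ℝ) (T : Fin 3 → Fin 3 → ℝ × V3 → ℝ)
    (hP : ContDiffOn ℝ 1 P (Tube a b r R))
    (hT : ∀ i j, ContDiffOn ℝ 1 (T i j) (Tube a b r R))
    (hf : ContinuousOn f (Tube a b r R))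
    (hmom : ∀ p ∈ Tube a b r R, ∀ j : Fin 3,
      ptD (fun p' => P p' j) p + ∑ i, pxD i (T i j) p = f p j)
    (s t : ℝ) (hs : s ∈ Set.Icc a b) (ht : t ∈ Set.Icc a b) :
    (∫ x in closedBall (r t) R, P (t, x)) - ∫ x in closedBall (r s) R, P (s, x) =
      (∫ t' in s..t, ∫ x in closedBall (r t') R, f (t', x))
      - κ • (∫ t' in s..t, ∫ x in sphere (r t') R,
            (fun j => ∑ i, nrm (r t') R x i * T i j (t', x)) ∂μH[2])
      + κ • (∫ t' in s..t, ∫ x in sphere (r t') R,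
          dot3 (fun i => deriv r t' i) (nrm (r t') R x) • P (t', x) ∂μH[2]) := by
  rcases (hs.1.trans hs.2).eq_or_lt with rfl | hab
  · have h1 : s = a := le_antisymm hs.2 hs.1
    have h2 : t = a := le_antisymm ht.2 ht.1
    subst h1; subst h2
    simp
  have hrc : Continuous r := hr.continuous
  have hu : Continuous (deriv r) := hr.continuous_deriv (by norm_num)
  have hui : ∀ i, Continuous (fun q : ℝ × V3 => deriv r q.1 i) := fun i => by fun_prop
  have c0i : ∀ i, ContinuousOn (fun q : ℝ × V3 => nrm (r q.1) R q.2 i) (Tube a b r R) := by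
    intro i
    simp only [nrm]
    fun_prop
  have c1 : ContinuousOn (fun q : ℝ × V3 => (fun j => ∑ i, nrm (r q.1) R q.2 i * T i j q : Fin 3 → ℝ)) (Tube a b r R) :=
    continuousOn_pi.2 fun j => continuousOn_finsetSum _ fun i _ => (c0i i).mul (hT i j).continuousOn
  have c2 : ContinuousOn (fun q : ℝ × V3 => dot3 (fun i => deriv r q.1 i) (nrm (r q.1) R q.2) • P q) (Tube a b r R) := by
    have c3 : ContinuousOn (fun q : ℝ × V3 => dot3 (fun i => deriv r q.1 i) (nrm (r q.1) R q.2)) (Tube a b r R) :=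
      continuousOn_finsetSum _ fun i _ => (hui i).continuousOn.mul (c0i i)
    exact c3.smul hP.continuousOn
  have i0 := ii_ball a b r hrc R f hf s t hs ht
  have i1 := ii_sph a b r hrc R hR _ c1 s t hs ht
  have i2 := ii_sph a b r hrc R hR _ c2 s t hs ht
  have hsub := Set.uIcc_subset_Icc hs ht
  ext j
  have hj := moving κ hκ a b hab R hR r hr (fun q => P q j) (fun q => f q j) (fun i => T i j)
    (contDiffOn_pi.1 hP j) (fun i => hT i j) ((continuous_apply j).comp_continuousOn hf)
    (fun q hq => hmom q hq j) s t hs ht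
  simp only [Pi.sub_apply, Pi.add_apply, Pi.smul_apply, smul_eq_mul]
  rw [ball_eval a b r R P hP.continuousOn t ht, ball_eval a b r R P hP.continuousOn s hs,
    ii_eval _ s t i0, ii_eval _ s t i1, ii_eval _ s t i2]
  have e0 : ∫ t' in s..t, (∫ x in closedBall (r t') R, f (t', x)) j =
      ∫ t' in s..t, ∫ x in closedBall (r t') R, f (t', x) j :=
    intervalIntegral.integral_congr fun t' ht' => ball_eval a b r R f hf t' (hsub ht') j
  have e1 := intervalIntegral.integral_congr (μ := volume) fun t' (ht' : t' ∈ Set.uIcc s t) => sph_eval a b r R hR _ c1 t' (hsub ht') j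
  have e2 := intervalIntegral.integral_congr (μ := volume) fun t' (ht' : t' ∈ Set.uIcc s t) => sph_eval a b r R hR _ c2 t' (hsub ht') j
  rw [e0, e1, e2]
  exact hj

end

noncomputable section
open MeasureTheory Complex Filter Topology Metric

/-- For `C¹` fields `P_n`, `T_n^{ij}` and continuous `f_n` on the shrinking
tubes satisfying the momentum equation, with bounded momentum integrals: (1) a subsequence
of `∫_{Ω_n} P_n(t₀) dx` converges to some `p_∞`; (2) if the boundary terms `Q₀, Q₀₁` vanish
uniformly, then along this subsequence
`∫_{Ω_n} P_n(t) dx = ∫_{t₀}^t ∫_{Ω_n} f_n + p_∞ + Q₀₀(t)` with `Q₀₀ → 0` uniformly. -/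
theorem statement4
    (Tm Tp t₀ : ℝ) (ht₀ : t₀ ∈ Set.Icc Tm Tp)
    (rhat : ℝ → V3) (htraj : IsTrajectory Tm Tp rhat)
    (R : ℕ → ℝ) (hRpos : ∀ n, 0 < R n) (hR0 : Tendsto R atTop (nhds 0))
    (P f : ℕ → ℝ × V3 → Fin 3 → ℝ) (T : ℕ → Fin 3 → Fin 3 → ℝ × V3 → ℝ)
    (hPsm : ∀ n, ContDiffOn ℝ 1 (P n) (Tube Tm Tp rhat (R n)))
    (hTsm : ∀ n i j, ContDiffOn ℝ 1 (T n i j) (Tube Tm Tp rhat (R n)))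
    (hfcont : ∀ n, ContinuousOn (f n) (Tube Tm Tp rhat (R n)))
    (hmom : ∀ n, ∀ p ∈ Tube Tm Tp rhat (R n), ∀ j : Fin 3,
      ptD (fun p' => P n p' j) p + ∑ i, pxD i (T n i j) p = f n p j)
    (hbound : ∃ C, ∀ n, ∀ t ∈ Set.Icc Tm Tp,
      ‖∫ x in closedBall (rhat t) (R n), P n (t, x)‖ ≤ C) :
    ∃ σ : ℕ → ℕ, StrictMono σ ∧ ∃ pinf : Fin 3 → ℝ,
      Tendsto (fun k => ∫ x in closedBall (rhat t₀) (R (σ k)), P (σ k) (t₀, x))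
        atTop (nhds pinf) ∧
      ((TendstoUniformlyOn
          (fun n t => ∫ t' in t₀..t, ∫ x in sphere (rhat t') (R n),
            (fun j => ∑ i, nrm (rhat t') (R n) x i * T n i j (t', x)) ∂μH[2])
          (fun _ => 0) atTop (Set.Icc Tm Tp) ∧
        TendstoUniformlyOn
          (fun n t => ∫ t' in t₀..t, ∫ x in sphere (rhat t') (R n),
            dot3 (fun i => deriv rhat t' i) (nrm (rhat t') (R n) x) • P n (t', x) ∂μH[2])
          (fun _ => 0) atTop (Set.Icc Tm Tp)) →
        ∃ Q00 : ℕ → ℝ → Fin 3 → ℝ,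
          TendstoUniformlyOn Q00 (fun _ => 0) atTop (Set.Icc Tm Tp) ∧
          ∀ k, ∀ t ∈ Set.Icc Tm Tp,
            (∫ x in closedBall (rhat t) (R (σ k)), P (σ k) (t, x))
              = (∫ t' in t₀..t, ∫ x in closedBall (rhat t') (R (σ k)), f (σ k) (t', x))
                + pinf + Q00 k t) := by
  obtain ⟨κ, hκ⟩ := exists_div_scaled
  obtain ⟨C, hC⟩ := hbound
  have hkey := fun n t ht => key_vec κ hκ Tm Tp (R n) (hRpos n) rhat htraj.1 (P n) (f n) (T n)
    (hPsm n) (hTsm n) (hfcont n) (hmom n) t₀ t ht₀ ht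
  obtain ⟨pinf, -, σ, hσ, hlim⟩ := tendsto_subseq_of_bounded
    (x := fun n => ∫ x in closedBall (rhat t₀) (R n), P n (t₀, x))
    (isBounded_closedBall (x := (0 : Fin 3 → ℝ)) (r := C))
    (fun n => by simpa using hC n t₀ ht₀)
  refine ⟨σ, hσ, pinf, hlim, ?_⟩
  rintro ⟨h0, h1⟩
  refine ⟨fun k t => (∫ x in closedBall (rhat t) (R (σ k)), P (σ k) (t, x))
    - (∫ t' in t₀..t, ∫ x in closedBall (rhat t') (R (σ k)), f (σ k) (t', x)) - pinf, ?_, ?_⟩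
  · have hu0 := (uniformContinuous_const_smul κ).comp_tendstoUniformlyOn
      (fun u hu => hσ.tendsto_atTop.eventually (h0 u hu))
    have hu1 := (uniformContinuous_const_smul κ).comp_tendstoUniformlyOn
      (fun u hu => hσ.tendsto_atTop.eventually (h1 u hu))
    have hl : TendstoUniformlyOn (fun k (_ : ℝ) =>
        (∫ x in closedBall (rhat t₀) (R (σ k)), P (σ k) (t₀, x)) - pinf) (fun _ => 0) atTop
        (Set.Icc Tm Tp) := by
      have hl0 := hlim.sub_const pinf
      rw [sub_self] at hl0
      exact hl0.tendstoUniformlyOn_const _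
    have hall := (hl.sub hu0).add hu1
    refine (hall.congr (Eventually.of_forall fun k t ht => ?_)).congr_right fun t ht => ?_
    · have := hkey (σ k) t ht
      have h2 := eq_add_of_sub_eq this
      simp only [Pi.add_apply, Pi.sub_apply, Function.comp]
      rw [h2]
      abel
    · simp
  · intro k t ht
    simp only
    abel

end
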